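/- There exist constants C = C(d, K) < ∞ and R_0 = R_0(d, K) < ∞ with the following property. Let r_+ := (φ d /(2σ_d))^{1/d} L and assume r_+ ≤ L/4. Then C_1 := (d−1) σ_d ∫_{−∞}^{∞} (sgn(t) + v(t)) t dt > 0, and for any R ≥ R_0, η ∈ [0,1], and r_η := η^{1/d}(φ d/(2σ_d))^{1/d} L with r_η ∈ [R, r_+], one has | ∫_Ω v_R(|x| − r_η) dx − L^d(−1+φη) − C_1 r_η^{d−2} | ≤ C ( r_η^{d−2} e^{−R/C} + ε ), where ε = e^{−R/C} if d = 2, 3 and ε = r_η^{d−4} if d ≥ 4. (Volume expansion for the droplet profile.) -/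

import Mathlib

open MeasureTheory Real Filter Topology

noncomputable section

/-- `Ed d` is Euclidean `d`-space. -/
abbrev Ed (d : ℕ) : Type := EuclideanSpace ℝ (Fin d)

/-- The fundamental domain `[-L/2, L/2]^d` of the flat torus of side length `L`. -/
def Box (d : ℕ) (L : ℝ) : Set (Ed d) := {x | ∀ i, x i ∈ Set.Ioc (-(L / 2)) (L / 2)}

/-- `σ_d`, the surface area of the unit sphere in `ℝ^d`. -/
def sphereArea (d : ℕ) : ℝ := d * (volume (Metric.ball (0 : Ed d) 1)).toReal

/-- The one-dimensional optimal transition profile `v(t) = -tanh(t/√2)`. -/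
def vprof (t : ℝ) : ℝ := -Real.tanh (t / Real.sqrt 2)

/-- The truncated profile `v_R`: odd, smooth, nonincreasing, with values in `[-1,1]`,
equal to `v` on `(-R, R)` and to `-sgn` outside `[-2R, 2R]`, exponentially close to
`-sgn` for `|t| ≥ R` and with exponentially decaying derivative (with constant `K`). -/
def IsProfile (K R : ℝ) (w : ℝ → ℝ) : Prop :=
  ContDiff ℝ (⊤ : ℕ∞) w ∧ (∀ t, w (-t) = -w t) ∧ Antitone w ∧ (∀ t, |w t| ≤ 1) ∧
    (∀ t, |t| < R → w t = vprof t) ∧ (∀ t, 2 * R < |t| → w t = -Real.sign t) ∧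
    (∀ t, R ≤ |t| → |w t + Real.sign t| ≤ K * Real.exp (-|t| / K)) ∧
    (∀ t, |deriv w t| ≤ K * Real.exp (-|t| / K))

/-- `C₁ = (d-1) σ_d ∫_ℝ (sgn t + v(t)) t dt`. -/
def C1const (d : ℕ) : ℝ := ((d : ℝ) - 1) * sphereArea d * ∫ t : ℝ, (Real.sign t + vprof t) * t

/-- A polynomial weight times a decaying exponential of the norm is integrable. -/
theorem integrable_one_add_norm_pow_mul_exp_neg {E : Type*} [NormedAddCommGroup E]
    [NormedSpace ℝ E] [FiniteDimensional ℝ E] [Nontrivial E] [MeasurableSpace E] [BorelSpace E]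
    (μ : Measure E) [μ.IsAddHaarMeasure] (n : ℕ) {b : ℝ} (hb : 0 < b) :
    Integrable (fun x : E => (1 + ‖x‖) ^ n * exp (-b * ‖x‖)) μ := by
  rw [integrable_fun_norm_addHaar μ (f := fun y : ℝ => (1 + y) ^ n * exp (-b * y))]
  set k := Module.finrank ℝ E - 1
  refine integrable_of_isBigO_exp_neg (half_pos hb) (by fun_prop) ?_
  refine Asymptotics.IsBigO.of_bound
    ((n + k).factorial / (b / 2) ^ (n + k) * exp (b / 2)) ?_
  filter_upwards [eventually_ge_atTop (0 : ℝ)] with y hy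
  have h1 : (1 + y) ^ (n + k) ≤
      (n + k).factorial / (b / 2) ^ (n + k) * exp (b / 2 * (1 + y)) := by
    have h := pow_div_factorial_le_exp (b / 2 * (1 + y)) (by positivity) (n + k)
    rw [div_le_iff₀ (by positivity), mul_pow] at h
    rw [div_mul_eq_mul_div, le_div_iff₀ (by positivity)]
    linarith
  have h2 : y ^ k ≤ (1 + y) ^ k := pow_le_pow_left₀ hy (by linarith) _
  rw [smul_eq_mul, Real.norm_of_nonneg (by positivity), Real.norm_of_nonneg (by positivity)]
  calc y ^ k * ((1 + y) ^ n * exp (-b * y))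
      ≤ (1 + y) ^ k * ((1 + y) ^ n * exp (-b * y)) := by gcongr
    _ = (1 + y) ^ (n + k) * exp (-b * y) := by ring
    _ ≤ (n + k).factorial / (b / 2) ^ (n + k) * exp (b / 2 * (1 + y)) * exp (-b * y) := by
        gcongr
    _ = (n + k).factorial / (b / 2) ^ (n + k) * (exp (b / 2 * (1 + y)) * exp (-b * y)) := by ring
    _ = (n + k).factorial / (b / 2) ^ (n + k) * (exp (b / 2) * exp (-(b / 2) * y)) := by
        rw [← exp_add, ← exp_add]; ring_nf
    _ = _ := by ring

/-- A measurable odd function on the line, bounded by `A e^{-b|t|}`. -/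
structure IsOddExpDecay (A b : ℝ) (g : ℝ → ℝ) : Prop where
  measurable : Measurable g
  odd : ∀ t, g (-t) = -g t
  abs_le : ∀ t, |g t| ≤ A * exp (-b * |t|)

theorem measurable_realSign : Measurable Real.sign := by
  unfold Real.sign
  exact Measurable.ite measurableSet_Iio measurable_const
    (Measurable.ite measurableSet_Ioi measurable_const measurable_const)

theorem abs_sign_add_vprof_le (t : ℝ) : |Real.sign t + vprof t| ≤ 2 * exp (-|t|) := by
  have key : ∀ s : ℝ, 0 < s → |1 + vprof s| ≤ 2 * exp (-s) := by
    intro s hs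
    have h2 : s ≤ 2 * (s / √2) := by
      have h3 : √2 ≤ 2 := by rw [Real.sqrt_le_left (by norm_num)]; norm_num
      rw [← mul_div_assoc, le_div_iff₀ (by positivity)]
      nlinarith
    set x := s / √2
    have hx : 1 + vprof s = 2 * exp (-x) / (exp x + exp (-x)) := by
      rw [vprof, Real.tanh_eq]
      field_simp
      ring
    rw [hx, abs_of_nonneg (by positivity), div_le_iff₀ (by positivity), mul_assoc]
    have h4 : exp (-x) ≤ exp (-s) * exp x := by
      rw [← exp_add]; exact exp_le_exp.2 (by linarith)
    nlinarith [mul_pos (exp_pos (-s)) (exp_pos (-x))]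
  rcases lt_trichotomy t 0 with h | rfl | h
  · have := key (-t) (by linarith)
    rw [abs_of_neg h, Real.sign_of_neg h, ← abs_neg]
    have e : -(-1 + vprof t) = 1 + vprof (-t) := by simp [vprof, neg_div, add_comm]
    rwa [e]
  · simp [vprof]
  · rw [abs_of_pos h, Real.sign_of_pos h]; exact key t h

theorem continuous_vprof : Continuous vprof := by
  unfold vprof
  simp_rw [Real.tanh_eq]
  exact (Continuous.div (by fun_prop) (by fun_prop) fun t => by positivity).neg

theorem realSign_neg (t : ℝ) : Real.sign (-t) = -Real.sign t := by
  rcases lt_trichotomy t 0 with h | rfl | h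
  · rw [Real.sign_of_neg h, Real.sign_of_pos (by linarith), neg_neg]
  · simp
  · rw [Real.sign_of_pos h, Real.sign_of_neg (by linarith)]

theorem two_mul_exp_neg_abs_le {K : ℝ} (hK : 1 ≤ K) (t : ℝ) :
    2 * exp (-|t|) ≤ 2 * K * exp (-(1 / K) * |t|) := by
  have h1 : exp (-|t|) ≤ exp (-(1 / K) * |t|) := by
    apply exp_le_exp.2
    have : 1 / K ≤ 1 := by rw [div_le_one (by linarith)]; exact hK
    nlinarith [abs_nonneg t]
  have := exp_pos (-|t|)
  nlinarith

theorem isOddExpDecay_sign_add_vprof {K : ℝ} (hK : 1 ≤ K) :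
    IsOddExpDecay (2 * K) (1 / K) (fun t => Real.sign t + vprof t) where
  measurable := measurable_realSign.add continuous_vprof.measurable
  odd t := by simp [realSign_neg, vprof, neg_div, add_comm]
  abs_le t := (abs_sign_add_vprof_le t).trans (two_mul_exp_neg_abs_le hK t)

theorem IsProfile.isOddExpDecay {K R : ℝ} (hK : 1 ≤ K) {w : ℝ → ℝ} (hw : IsProfile K R w) :
    IsOddExpDecay (2 * K) (1 / K) (fun t => Real.sign t + w t) where
  measurable := measurable_realSign.add hw.1.continuous.measurable
  odd t := by simp [realSign_neg, hw.2.1, add_comm]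
  abs_le t := by
    obtain ⟨-, -, -, -, hin, -, hout, -⟩ := hw
    rcases lt_or_ge |t| R with h | h
    · simp only [hin t h]
      exact (abs_sign_add_vprof_le t).trans (two_mul_exp_neg_abs_le hK t)
    · rw [add_comm]
      refine (hout t h).trans ?_
      rw [show -|t| / K = -(1 / K) * |t| by ring]
      have := exp_pos (-(1 / K) * |t|)
      nlinarith

theorem C1const_pos {d : ℕ} (hd : 2 ≤ d) : 0 < C1const d := by
  have hd' : (2 : ℝ) ≤ d := by exact_mod_cast hd
  have hdec := isOddExpDecay_sign_add_vprof le_rfl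
  have hnn : ∀ t : ℝ, t ≠ 0 → 0 < (Real.sign t + vprof t) * t := by
    have hlt : ∀ s : ℝ, vprof s < 1 ∧ -1 < vprof s := fun s => by
      have := Real.tanh_lt_one (s / √2)
      have := Real.neg_one_lt_tanh (s / √2)
      constructor <;> simp only [vprof] <;> linarith
    intro t ht
    rcases lt_or_gt_of_ne ht with h | h
    · rw [Real.sign_of_neg h]; nlinarith [(hlt t).1]
    · rw [Real.sign_of_pos h]; nlinarith [(hlt t).2]
  have hint : Integrable (fun t : ℝ => (Real.sign t + vprof t) * t) := by
    refine ((integrable_one_add_norm_pow_mul_exp_neg (volume : Measure ℝ) 1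
      one_pos).const_mul 2).mono' (hdec.measurable.mul measurable_id).aestronglyMeasurable
      (ae_of_all _ fun t => ?_)
    have h := hdec.abs_le t
    simp only [Real.norm_eq_abs, abs_mul, div_one, mul_one] at h ⊢
    have := exp_pos (-1 * |t|)
    nlinarith [abs_nonneg t, mul_le_mul_of_nonneg_right h (abs_nonneg t)]
  have hball : 0 < sphereArea d := by
    refine mul_pos (by linarith) (ENNReal.toReal_pos ?_ measure_ball_lt_top.ne)
    exact (Metric.measure_ball_pos _ _ one_pos).ne'
  refine mul_pos (mul_pos (by linarith) hball) ?_
  rw [integral_pos_iff_support_of_nonneg (fun t => ?_) hint]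
  · refine lt_of_lt_of_le ?_ (measure_mono (s := Set.Ioo (0 : ℝ) 1) fun t ht => ?_)
    · simp
    · exact (hnn t ht.1.ne').ne'
  · rcases eq_or_ne t 0 with rfl | h
    · simp
    · exact (hnn t h).le

theorem IsOddExpDecay.integrable_pow_mul {A b : ℝ} (hb : 0 < b) {g : ℝ → ℝ}
    (hg : IsOddExpDecay A b g) (n : ℕ) : Integrable (fun t => t ^ n * g t) := by
  refine ((integrable_one_add_norm_pow_mul_exp_neg (volume : Measure ℝ) n hb).const_mul A).mono'
    ((measurable_id.pow_const n).mul hg.measurable).aestronglyMeasurable (ae_of_all _ fun t => ?_)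
  rw [Real.norm_eq_abs, abs_mul, abs_pow, Real.norm_eq_abs]
  have h1 : |t| ^ n ≤ (1 + |t|) ^ n := by gcongr; linarith
  calc |t| ^ n * |g t| ≤ (1 + |t|) ^ n * (A * exp (-b * |t|)) :=
        mul_le_mul h1 (hg.abs_le t) (abs_nonneg _) (by positivity)
    _ = _ := by ring

theorem IsOddExpDecay.integral_even_pow_mul {A b : ℝ} {g : ℝ → ℝ}
    (hg : IsOddExpDecay A b g) {n : ℕ} (hn : Even n) : ∫ t, t ^ n * g t = 0 := by
  have h := integral_neg_eq_self (fun t => t ^ n * g t) volume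
  simp only [hn.neg_pow, hg.odd, mul_neg, integral_neg] at h
  linarith

theorem sum_range_add_four (f : ℕ → ℝ) (k : ℕ) : ∑ i ∈ Finset.range (k + 3 + 1), f i =
    (∑ i ∈ Finset.range (k + 1), f (i + 3)) + f 2 + f 1 + f 0 := by
  rw [Finset.sum_range_succ', Finset.sum_range_succ', Finset.sum_range_succ']

/-- The Taylor remainder of `(t + r)^n` after the quadratic term. -/
theorem abs_add_pow_sub_quadratic_le {r : ℝ} (hr : 1 ≤ r) (n : ℕ) (t : ℝ) :
    |(t + r) ^ n - (r ^ n + n * r ^ (n - 1) * t + n.choose 2 * r ^ (n - 2) * t ^ 2)| ≤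
      (if n ≤ 2 then 0 else r ^ (n - 3)) * (1 + |t|) ^ n := by
  rcases le_or_gt n 2 with h | h
  · interval_cases n <;> simp
    all_goals ring_nf
  obtain ⟨k, rfl⟩ : ∃ k, n = k + 3 := ⟨n - 3, by omega⟩
  rw [if_neg (by omega), show k + 3 - 3 = k by omega, show k + 3 - 1 = k + 2 by omega,
    show k + 3 - 2 = k + 1 by omega]
  have e : (t + r) ^ (k + 3) - (r ^ (k + 3) + ((k + 3 : ℕ) : ℝ) * r ^ (k + 2) * t +
      (k + 3).choose 2 * r ^ (k + 1) * t ^ 2) =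
      ∑ i ∈ Finset.range (k + 1), t ^ (i + 3) * r ^ (k - i) * (k + 3).choose (i + 3) := by
    rw [add_pow, sum_range_add_four]
    have : ∀ i, k + 3 - (i + 3) = k - i := fun i => by omega
    simp only [this, show k + 3 - 2 = k + 1 by omega, show k + 3 - 1 = k + 2 by omega]
    simp
    ring
  rw [e, add_comm 1 |t|, add_pow, sum_range_add_four]
  have hr0 : 0 ≤ r := by linarith
  calc _ ≤ ∑ i ∈ Finset.range (k + 1), |t ^ (i + 3) * r ^ (k - i) * (k + 3).choose (i + 3)| :=
        Finset.abs_sum_le_sum_abs _ _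
    _ ≤ ∑ i ∈ Finset.range (k + 1), r ^ k * (|t| ^ (i + 3) * (k + 3).choose (i + 3)) := by
        refine Finset.sum_le_sum fun i _ => ?_
        rw [abs_mul, abs_mul, abs_pow, abs_of_nonneg (pow_nonneg hr0 _), Nat.abs_cast]
        have : r ^ (k - i) ≤ r ^ k := pow_le_pow_right₀ hr (by omega)
        calc _ ≤ |t| ^ (i + 3) * r ^ k * (k + 3).choose (i + 3) := by gcongr
          _ = _ := by ring
    _ ≤ _ := by
        rw [← Finset.mul_sum]
        refine mul_le_mul_of_nonneg_left ?_ (pow_nonneg hr0 _)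
        simp only [one_pow, mul_one]
        rw [add_assoc, add_assoc]
        exact le_add_of_nonneg_right (by positivity)

/-- Expansion of the radial integral of an odd decaying function centred at radius `r`. -/
theorem IsOddExpDecay.radial_expansion {A b : ℝ} (hA : 0 ≤ A) (hb : 0 < b) {g : ℝ → ℝ}
    (hg : IsOddExpDecay A b g) {r : ℝ} (hr : 1 ≤ r) (n : ℕ) :
    |(∫ y in Set.Ioi (0 : ℝ), y ^ n * g (y - r)) - n * r ^ (n - 1) * ∫ t, t * g t| ≤
      (exp (-(b / 2) * r) + if n ≤ 2 then 0 else r ^ (n - 3)) *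
        (A * ∫ t : ℝ, (1 + ‖t‖) ^ n * exp (-(b / 2) * ‖t‖)) := by
  set P : ℝ := if n ≤ 2 then 0 else r ^ (n - 3) with hP
  have hP0 : 0 ≤ P := by rw [hP]; split_ifs <;> positivity
  set F : ℝ → ℝ := (Set.Ioi (-r)).indicator fun t => (t + r) ^ n * g t
  set H : ℝ → ℝ := fun t => r ^ n * (t ^ 0 * g t) + n * r ^ (n - 1) * (t ^ 1 * g t) +
    n.choose 2 * r ^ (n - 2) * (t ^ 2 * g t)
  have hF : ∫ y in Set.Ioi (0 : ℝ), y ^ n * g (y - r) = ∫ t, F t := by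
    rw [← integral_indicator measurableSet_Ioi, ← integral_add_right_eq_self _ r]
    refine integral_congr_ae (ae_of_all _ fun t => ?_)
    simp only [F, Set.indicator, Set.mem_Ioi, add_sub_cancel_right, neg_lt_iff_pos_add]
  have i0 := (hg.integrable_pow_mul hb 0).const_mul (r ^ n)
  have i1 := (hg.integrable_pow_mul hb 1).const_mul (n * r ^ (n - 1))
  have i2 := (hg.integrable_pow_mul hb 2).const_mul (n.choose 2 * r ^ (n - 2))
  have i01 : Integrable (fun t => r ^ n * (t ^ 0 * g t) + n * r ^ (n - 1) * (t ^ 1 * g t)) :=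
    i0.add i1
  have hHint : Integrable H := i01.add i2
  have hH : ∫ t, H t = n * r ^ (n - 1) * ∫ t, t * g t := by
    simp only [H]
    rw [integral_add i01 i2, integral_add i0 i1, integral_const_mul, integral_const_mul,
      integral_const_mul, hg.integral_even_pow_mul Even.zero, hg.integral_even_pow_mul even_two]
    simp
  have hJ := integrable_one_add_norm_pow_mul_exp_neg (volume : Measure ℝ) n (half_pos hb)
  have hpt : ∀ t, ‖F t - H t‖ ≤
      (exp (-(b / 2) * r) + P) * (A * ((1 + ‖t‖) ^ n * exp (-(b / 2) * ‖t‖))) := by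
    intro t
    have hg1 : |g t| ≤ A * exp (-(b / 2) * |t|) := (hg.abs_le t).trans <| by
      gcongr
      nlinarith [abs_nonneg t]
    have hrem : |((t + r) ^ n - (r ^ n + n * r ^ (n - 1) * t + n.choose 2 * r ^ (n - 2) * t ^ 2))
        * g t| ≤ P * (A * ((1 + |t|) ^ n * exp (-(b / 2) * |t|))) := by
      rw [abs_mul]
      calc _ ≤ (P * (1 + |t|) ^ n) * (A * exp (-(b / 2) * |t|)) :=
            mul_le_mul (abs_add_pow_sub_quadratic_le hr n t) hg1 (abs_nonneg _) (by positivity)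
        _ = _ := by ring
    have hHt : H t = (r ^ n + n * r ^ (n - 1) * t + n.choose 2 * r ^ (n - 2) * t ^ 2) * g t := by
      simp only [H]; ring
    rw [Real.norm_eq_abs, Real.norm_eq_abs, add_mul]
    by_cases ht : -r < t
    · have hFt : F t = (t + r) ^ n * g t := Set.indicator_of_mem ht _
      rw [hFt, hHt, ← sub_mul]
      exact hrem.trans (le_add_of_nonneg_left (by positivity))
    · have hFt : F t = 0 := Set.indicator_of_notMem ht _
      have htr : t ≤ -r := not_lt.1 ht
      have habs : |t| = -t := abs_of_nonpos (by linarith)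
      have htail : |(t + r) ^ n * g t| ≤
          exp (-(b / 2) * r) * (A * ((1 + |t|) ^ n * exp (-(b / 2) * |t|))) := by
        rw [abs_mul, abs_pow]
        have h1 : |t + r| ≤ 1 + |t| := by
          rw [abs_of_nonpos (by linarith), habs]; linarith
        have h2 : |g t| ≤ A * (exp (-(b / 2) * r) * exp (-(b / 2) * |t|)) := by
          refine (hg.abs_le t).trans ?_
          rw [← exp_add]
          gcongr
          nlinarith
        calc _ ≤ (1 + |t|) ^ n * (A * (exp (-(b / 2) * r) * exp (-(b / 2) * |t|))) := by gcongr
          _ = _ := by ring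
      rw [hFt, hHt]
      have e : 0 - (r ^ n + n * r ^ (n - 1) * t + n.choose 2 * r ^ (n - 2) * t ^ 2) * g t =
        ((t + r) ^ n - (r ^ n + n * r ^ (n - 1) * t + n.choose 2 * r ^ (n - 2) * t ^ 2)) * g t
          - (t + r) ^ n * g t := by ring
      rw [e]
      refine (abs_sub _ _).trans ?_
      linarith
  have hdom := (hJ.const_mul A).const_mul (exp (-(b / 2) * r) + P)
  have hFm : AEStronglyMeasurable F :=
    ((((measurable_id.add_const r).pow_const n).mul hg.measurable).indicator
      measurableSet_Ioi).aestronglyMeasurable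
  have hFint : Integrable F := by
    have := (hdom.mono' (hFm.sub hHint.1) (ae_of_all _ hpt)).add hHint
    simpa using this
  rw [hF, ← hH, ← integral_sub hFint hHint, ← integral_const_mul, ← integral_const_mul,
    ← Real.norm_eq_abs]
  exact norm_integral_le_of_norm_le hdom (ae_of_all _ hpt)

/-- First moments of two odd decaying functions that agree on `(-R, R)`. -/
theorem IsOddExpDecay.abs_first_moment_sub_le {A b : ℝ} (hA : 0 ≤ A) (hb : 0 < b)
    {g h : ℝ → ℝ} (hg : IsOddExpDecay A b g) (hh : IsOddExpDecay A b h) {R : ℝ}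
    (heq : ∀ t, |t| < R → g t = h t) :
    |(∫ t, t * g t) - ∫ t, t * h t| ≤
      exp (-(b / 2) * R) * (2 * A * ∫ t : ℝ, (1 + ‖t‖) ^ 1 * exp (-(b / 2) * ‖t‖)) := by
  have ig := hg.integrable_pow_mul hb 1
  have ih := hh.integrable_pow_mul hb 1
  simp only [pow_one] at ig ih
  have hJ := integrable_one_add_norm_pow_mul_exp_neg (volume : Measure ℝ) 1 (half_pos hb)
  rw [← integral_sub ig ih, ← integral_const_mul, ← integral_const_mul,
    ← Real.norm_eq_abs]
  refine norm_integral_le_of_norm_le ((hJ.const_mul _).const_mul _) (ae_of_all _ fun t => ?_)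
  rw [Real.norm_eq_abs, Real.norm_eq_abs, ← mul_sub, abs_mul]
  rcases lt_or_ge |t| R with ht | ht
  · rw [heq t ht, sub_self, abs_zero, mul_zero]
    positivity
  · have h1 : |g t - h t| ≤ 2 * A * exp (-b * |t|) := by
      linarith [abs_sub (g t) (h t), hg.abs_le t, hh.abs_le t]
    have h2 : exp (-b * |t|) ≤ exp (-(b / 2) * R) * exp (-(b / 2) * |t|) := by
      rw [← exp_add]
      gcongr
      nlinarith
    calc |t| * |g t - h t| ≤ (1 + |t|) * (2 * A * (exp (-(b / 2) * R) * exp (-(b / 2) * |t|))) := by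
          gcongr
          · linarith
          · exact h1.trans (by gcongr)
      _ = _ := by ring

theorem box_eq_preimage (d : ℕ) (L : ℝ) : Box d L = (WithLp.ofLp : Ed d → Fin d → ℝ) ⁻¹'
    Set.pi Set.univ fun _ => Set.Ioc (-(L / 2)) (L / 2) := by
  ext x; simp [Box]

theorem measurableSet_box (d : ℕ) (L : ℝ) : MeasurableSet (Box d L) := by
  rw [box_eq_preimage]
  exact (PiLp.volume_preserving_ofLp (Fin d)).measurable
    (MeasurableSet.univ_pi fun _ => measurableSet_Ioc)

theorem volume_box (d : ℕ) {L : ℝ} (hL : 0 ≤ L) :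
    volume (Box d L) = ENNReal.ofReal (L ^ d) := by
  rw [box_eq_preimage, (PiLp.volume_preserving_ofLp (Fin d)).measure_preimage
    (MeasurableSet.univ_pi fun _ => measurableSet_Ioc).nullMeasurableSet, Real.volume_pi_Ioc]
  simp [ENNReal.ofReal_pow hL]

theorem half_le_norm_of_notMem_box {d : ℕ} {L : ℝ} {x : Ed d} (hx : x ∉ Box d L) :
    L / 2 ≤ ‖x‖ := by
  simp only [Box, Set.mem_ofPred_eq, not_forall, Set.mem_Ioc, not_and_or, not_lt, not_le] at hx
  obtain ⟨i, hi⟩ := hx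
  have h := PiLp.norm_apply_le x i
  rw [Real.norm_eq_abs] at h
  rcases hi with hi | hi
  · linarith [neg_le_abs (x i)]
  · linarith [le_abs_self (x i)]

theorem IsOddExpDecay.integrable_radial {E : Type*} [NormedAddCommGroup E]
    [NormedSpace ℝ E] [FiniteDimensional ℝ E] [Nontrivial E] [MeasurableSpace E] [BorelSpace E]
    (μ : Measure E) [μ.IsAddHaarMeasure] {A b : ℝ} (hA : 0 ≤ A) (hb : 0 < b) {g : ℝ → ℝ}
    (hg : IsOddExpDecay A b g) (r : ℝ) : Integrable (fun x : E => g (‖x‖ - r)) μ := by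
  refine ((integrable_one_add_norm_pow_mul_exp_neg μ 0 hb).const_mul (A * exp (b * r))).mono'
    (hg.measurable.comp (measurable_norm.sub_const r)).aestronglyMeasurable
    (ae_of_all _ fun x => (hg.abs_le _).trans ?_)
  rw [pow_zero, one_mul, mul_assoc, ← exp_add]
  gcongr
  nlinarith [le_abs_self (‖x‖ - r)]

/-- Passing from the box to the whole space costs an exponentially small error. -/
theorem IsOddExpDecay.abs_setIntegral_box_sub_le {d : ℕ} [Nontrivial (Ed d)] {A b : ℝ}
    (hA : 0 ≤ A) (hb : 0 < b) {g : ℝ → ℝ} (hg : IsOddExpDecay A b g) {r L : ℝ}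
    (hrL : r ≤ L / 4) :
    |(∫ x in Box d L, g (‖x‖ - r)) - ∫ x : Ed d, g (‖x‖ - r)| ≤
      exp (-(b / 8) * L) * (A * ∫ x : Ed d, (1 + ‖x‖) ^ 0 * exp (-(b / 4) * ‖x‖)) := by
  have hint := hg.integrable_radial (volume : Measure (Ed d)) hA hb r
  have hJ := integrable_one_add_norm_pow_mul_exp_neg (volume : Measure (Ed d)) 0
    (b := b / 4) (by positivity)
  rw [← integral_indicator (measurableSet_box d L),
    ← integral_sub (hint.indicator (measurableSet_box d L)) hint,
    ← integral_const_mul, ← integral_const_mul, ← Real.norm_eq_abs]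
  refine norm_integral_le_of_norm_le ((hJ.const_mul _).const_mul _) (ae_of_all _ fun x => ?_)
  by_cases hx : x ∈ Box d L
  · rw [Set.indicator_of_mem hx, sub_self, norm_zero]
    positivity
  · rw [Set.indicator_of_notMem hx, zero_sub, norm_neg]
    refine (hg.abs_le _).trans ?_
    have hn := half_le_norm_of_notMem_box hx
    rw [pow_zero, one_mul, mul_left_comm, ← exp_add]
    gcongr
    nlinarith [le_abs_self (‖x‖ - r)]

theorem ball_subset_box {d : ℕ} {r L : ℝ} (hrL : r < L / 2) :
    Metric.ball (0 : Ed d) r ⊆ Box d L := by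
  intro x hx
  by_contra h
  have := half_le_norm_of_notMem_box h
  rw [mem_ball_zero_iff] at hx
  linarith

/-- The sharp interface contributes `-L^d` plus twice the volume of the ball. -/
theorem setIntegral_box_profile {d : ℕ} [Nontrivial (Ed d)] {A b : ℝ}
    (hA : 0 ≤ A) (hb : 0 < b) {w : ℝ → ℝ} (hg : IsOddExpDecay A b fun t => Real.sign t + w t)
    {r L : ℝ} (hr : 0 ≤ r) (hL : 0 < L) (hrL : r ≤ L / 4) :
    ∫ x in Box d L, w (‖x‖ - r) =
      -L ^ d + 2 * (r ^ d * (volume (Metric.ball (0 : Ed d) 1)).toReal) +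
        ∫ x in Box d L, (Real.sign (‖x‖ - r) + w (‖x‖ - r)) := by
  have hint := (hg.integrable_radial (volume : Measure (Ed d)) hA hb r).integrableOn
    (s := Box d L)
  have hBfin : volume (Box d L) ≠ ⊤ := by rw [volume_box d hL.le]; exact ENNReal.ofReal_ne_top
  have hball : Integrable ((Metric.ball (0 : Ed d) r).indicator fun _ => (2 : ℝ))
      (volume.restrict (Box d L)) :=
    (((integrable_const_iff).2 (Or.inr ⟨by simp [Ne.lt_top hBfin]⟩)).indicator
      Metric.isOpen_ball.measurableSet)
  have hconst : Integrable (fun _ : Ed d => (-1 : ℝ)) (volume.restrict (Box d L)) :=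
    (integrable_const_iff).2 (Or.inr ⟨by simp [Ne.lt_top hBfin]⟩)
  have hsharp : Integrable (fun x : Ed d =>
      -1 + (Metric.ball (0 : Ed d) r).indicator (fun _ => (2 : ℝ)) x)
      (volume.restrict (Box d L)) := hconst.add hball
  have hae : ∀ᵐ x ∂(volume.restrict (Box d L)), w (‖x‖ - r) =
      (-1 + (Metric.ball (0 : Ed d) r).indicator (fun _ => (2 : ℝ)) x) +
        (Real.sign (‖x‖ - r) + w (‖x‖ - r)) := by
    refine ae_restrict_of_ae ?_
    have h0 : ∀ᵐ x ∂(volume : Measure (Ed d)), x ∉ Metric.sphere (0 : Ed d) r :=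
      measure_eq_zero_iff_ae_notMem.1 (Measure.addHaar_sphere _ _ _)
    filter_upwards [h0] with x hx
    rw [mem_sphere_zero_iff_norm] at hx
    rcases lt_or_gt_of_ne hx with h | h
    · rw [Set.indicator_of_mem (by simpa using h), Real.sign_of_neg (by linarith)]
      ring
    · rw [Set.indicator_of_notMem (by simpa using h.le), Real.sign_of_pos (by linarith)]
      ring
  rw [integral_congr_ae hae, integral_add hsharp hint, integral_add hconst hball,
    integral_indicator Metric.isOpen_ball.measurableSet,
    Measure.restrict_restrict Metric.isOpen_ball.measurableSet,
    Set.inter_eq_left.2 (ball_subset_box (by linarith)), setIntegral_const, setIntegral_const,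
    Measure.real, Measure.real, Measure.addHaar_ball _ _ hr, volume_box d hL.le,
    ENNReal.toReal_mul, ENNReal.toReal_ofReal (by positivity), ENNReal.toReal_ofReal (by positivity),
    finrank_euclideanSpace_fin]
  simp only [smul_eq_mul]
  ring

set_option maxHeartbeats 1000000 in
/-- **Volume expansion for the droplet profile.** There are constants `C = C(d,K) < ∞` and
`R₀ = R₀(d,K) < ∞` such that `C₁ > 0` and, whenever `r₊ = (φd/(2σ_d))^{1/d} L ≤ L/4`,
`R ≥ R₀`, `η ∈ [0,1]`, and `r_η = η^{1/d}(φd/(2σ_d))^{1/d} L ∈ [R, r₊]`, one has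
`|∫_Ω v_R(|x| - r_η) dx - L^d(-1+φη) - C₁ r_η^{d-2}| ≤ C (r_η^{d-2} e^{-R/C} + ε)`,
where `ε = e^{-R/C}` for `d = 2, 3` and `ε = r_η^{d-4}` for `d ≥ 4`. -/
theorem droplet_volume_expansion (d : ℕ) (hd : 2 ≤ d) (K : ℝ) (hK : 1 ≤ K) :
    0 < C1const d ∧
    ∃ C : ℝ, 0 < C ∧ ∃ R₀ : ℝ,
      ∀ L φ : ℝ, 0 < L → 0 < φ → φ < 1 →
        ∀ rplus : ℝ, rplus = (φ * (d : ℝ) / (2 * sphereArea d)) ^ ((1 : ℝ) / d) * L →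
          rplus ≤ L / 4 →
          ∀ R : ℝ, R₀ ≤ R → ∀ w : ℝ → ℝ, IsProfile K R w →
            ∀ η ∈ Set.Icc (0 : ℝ) 1,
              ∀ rη : ℝ,
                rη = η ^ ((1 : ℝ) / d) * (φ * (d : ℝ) / (2 * sphereArea d)) ^ ((1 : ℝ) / d) * L →
                R ≤ rη → rη ≤ rplus →
                |(∫ x in Box d L, w (‖x‖ - rη)) - L ^ d * (-1 + φ * η) -
                    C1const d * rη ^ (d - 2)| ≤
                  C * (rη ^ (d - 2) * Real.exp (-R / C) +
                    (if d ≤ 3 then Real.exp (-R / C) else rη ^ (d - 4))) := by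
  refine ⟨C1const_pos hd, ?_⟩
  have hd0 : (0 : ℝ) < d := by exact_mod_cast (by omega : 0 < d)
  have hK0 : 0 < K := by linarith
  have hb : 0 < 1 / K := by positivity
  have hA : 0 ≤ 2 * K := by positivity
  have : Nontrivial (Ed d) := Module.nontrivial_of_finrank_pos (R := ℝ) (by
    rw [finrank_euclideanSpace_fin]; omega)
  set V := (volume (Metric.ball (0 : Ed d) 1)).toReal with hV
  have hV0 : 0 < V :=
    ENNReal.toReal_pos (Metric.measure_ball_pos _ _ one_pos).ne' measure_ball_lt_top.ne
  set σ := sphereArea d with hσ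
  have hσV : σ = d * V := rfl
  have hσ0 : 0 < σ := by rw [hσV]; positivity
  set b := 1 / K with hbK
  set A := 2 * K with hAK
  set J₁ := A * ∫ t : ℝ, (1 + ‖t‖) ^ (d - 1) * exp (-(b / 2) * ‖t‖)
  set J₂ := 2 * A * ∫ t : ℝ, (1 + ‖t‖) ^ 1 * exp (-(b / 2) * ‖t‖)
  set J₃ := A * ∫ x : Ed d, (1 + ‖x‖) ^ 0 * exp (-(b / 4) * ‖x‖)
  have hJ₁ : 0 ≤ J₁ := mul_nonneg hA (integral_nonneg fun t => by positivity)
  have hJ₂ : 0 ≤ J₂ := mul_nonneg (by positivity) (integral_nonneg fun t => by positivity)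
  have hJ₃ : 0 ≤ J₃ := mul_nonneg hA (integral_nonneg fun t => by positivity)
  have hn0 : 0 ≤ (d : ℝ) - 1 := by
    have : (2 : ℝ) ≤ d := by exact_mod_cast hd
    linarith
  set M := σ * J₁ + σ * (d - 1) * J₂ + J₃ with hM
  have hM0 : 0 ≤ M := by positivity
  refine ⟨M + A, by positivity, 1, ?_⟩
  intro L φ hL hφ _ rplus hrplus hrL R hR w hw η hη r hr hRr hrr
  have hr1 : 1 ≤ r := hR.trans hRr
  have hrL4 : r ≤ L / 4 := hrr.trans hrL
  have hg := hw.isOddExpDecay hK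
  have hg₀ := isOddExpDecay_sign_add_vprof hK
  have hbox := setIntegral_box_profile (d := d) hA hb hg (by linarith) hL hrL4
  have hvol : 2 * (r ^ d * V) = L ^ d * (φ * η) := by
    have hroot : ∀ x : ℝ, 0 ≤ x → (x ^ ((1 : ℝ) / d)) ^ d = x := fun x hx => by
      rw [one_div, Real.rpow_inv_natCast_pow hx (by omega)]
    rw [hr, mul_pow, mul_pow, hroot _ hη.1, hroot _ (by positivity), hσV]
    field_simp
  have hout := hg.abs_setIntegral_box_sub_le (d := d) hA hb hrL4
  have hrad := hg.radial_expansion hA hb hr1 (d - 1)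
  have hmom := hg.abs_first_moment_sub_le (R := R) hA hb hg₀ fun t ht => by
    simp only [hw.2.2.2.2.1 t ht]
  have hpolar := integral_fun_norm_addHaar (volume : Measure (Ed d))
    (fun y => Real.sign (y - r) + w (y - r))
  simp only [finrank_euclideanSpace_fin, nsmul_eq_mul, smul_eq_mul] at hpolar
  have hC1 : C1const d = (d - 1) * σ * ∫ t : ℝ, t * (Real.sign t + vprof t) := by
    simp only [C1const, mul_comm]
    rfl
  rw [hbox, hC1]
  set T := ∫ x in Box d L, (Real.sign (‖x‖ - r) + w (‖x‖ - r))
  set S := ∫ x : Ed d, (Real.sign (‖x‖ - r) + w (‖x‖ - r))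
  set Q := ∫ y in Set.Ioi (0 : ℝ), y ^ (d - 1) * (Real.sign (y - r) + w (y - r))
  set I := ∫ t : ℝ, t * (Real.sign t + w t)
  set I₀ := ∫ t : ℝ, t * (Real.sign t + vprof t)
  have hS : S = σ * Q := by rw [hpolar, hσV, hV, Measure.real]; ring
  rw [show d - 1 - 1 = d - 2 by omega, show d - 1 - 3 = d - 4 by omega,
    Nat.cast_sub (by omega : 1 ≤ d), Nat.cast_one] at hrad
  set P : ℝ := if d - 1 ≤ 2 then 0 else r ^ (d - 4) with hP
  set N := exp (-R / (M + A)) with hN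
  set ε : ℝ := if d ≤ 3 then N else r ^ (d - 4) with hε
  have hPε : P ≤ ε := by
    rw [hP, hε]
    by_cases h : d ≤ 3
    · rw [if_pos (by omega), if_pos h]; positivity
    · rw [if_neg (by omega), if_neg h]
  have hε0 : 0 ≤ ε := by rw [hε]; split_ifs <;> positivity
  set X := exp (-(b / 2) * R) with hX
  have hXN : X ≤ N := by
    rw [hX, hN]
    refine exp_le_exp.2 ?_
    have h1 : b / 2 = 1 / A := by rw [hbK, hAK]; field_simp
    have h2 : 1 / (M + A) ≤ 1 / A := one_div_le_one_div_of_le (by positivity) (by linarith)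
    rw [h1, show -R / (M + A) = -(1 / (M + A)) * R by ring]
    nlinarith
  have hXr : exp (-(b / 2) * r) ≤ X := exp_le_exp.2 (by nlinarith)
  have hXL : exp (-(b / 8) * L) ≤ X := exp_le_exp.2 (by nlinarith)
  have hX0 : 0 < X := exp_pos _
  set ρ := r ^ (d - 2)
  have hρ : 1 ≤ ρ := one_le_pow₀ hr1
  have hXρ : X ≤ ρ * X := le_mul_of_one_le_left hX0.le hρ
  have e : -L ^ d + 2 * (r ^ d * V) + T - L ^ d * (-1 + φ * η) - (d - 1) * σ * I₀ * ρ =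
      (T - S) + σ * (Q - (d - 1) * ρ * I) + σ * (d - 1) * ρ * (I - I₀) := by
    rw [hvol, hS]; ring
  rw [e]
  calc _ ≤ |T - S| + |σ * (Q - (d - 1) * ρ * I)| + |σ * (d - 1) * ρ * (I - I₀)| :=
        abs_add_three _ _ _
    _ = |T - S| + σ * |Q - (d - 1) * ρ * I| + σ * (d - 1) * ρ * |I - I₀| := by
        rw [abs_mul, abs_mul, abs_of_pos hσ0,
          abs_of_nonneg (by positivity : 0 ≤ σ * ((d : ℝ) - 1) * ρ)]
    _ ≤ ρ * X * J₃ + σ * ((ρ * X + ε) * J₁) + σ * (d - 1) * ρ * (X * J₂) := by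
        gcongr
        · exact hout.trans (by gcongr; exact hXL.trans hXρ)
        · exact hrad.trans (by gcongr; exact hXr.trans hXρ)
    _ = M * (ρ * X) + σ * J₁ * ε := by rw [hM]; ring
    _ ≤ (M + A) * (ρ * N) + (M + A) * ε := by
        have : σ * J₁ ≤ M + A := by
          have : 0 ≤ σ * ((d : ℝ) - 1) * J₂ := by positivity
          linarith
        gcongr
        linarith
    _ = _ := by ring
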